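/- (Collapsing colors is a homotopy equivalence.) With notation as above, σ̄ : C̄_X → C̄_W is an R_X-chain homotopy equivalence, where C̄_W carries the R_X-action obtained by restricting its R_W-action along R_σ. -/

import Mathlib

/-!
STATEMENT 11 (Collapsing colors is a homotopy equivalence): With notation as in
Statement 10, σ̄ = Id_C ⊗ R_σ ⊗ Ξ_σ : C̄_X → C̄_W is an R_X-chain homotopy equivalence,
where C̄_W carries the R_X-action obtained by restricting its R_W-action along R_σ:
there are an R_X-linear chain map g : C̄_W → C̄_X and R_X-linear homotopies H, H' with
∂H + H∂ = g∘σ̄ + Id and ∂H' + H'∂ = σ̄∘g + Id (characteristic 2).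
-/

set_option synthInstance.maxHeartbeats 1000000
set_option maxHeartbeats 1000000

noncomputable section
open scoped TensorProduct

abbrev F2 := ZMod 2

abbrev Rgen (Y : Type) : Type :=
  MvPolynomial Y F2 ⧸
    Ideal.span (Set.range fun y : Y => (MvPolynomial.X y : MvPolynomial Y F2) ^ 2)

def rgen {Y : Type} (y : Y) : Rgen Y := Ideal.Quotient.mk _ (MvPolynomial.X y)

abbrev XiX (Y : Type) : Type := (Y →₀ ℕ) →₀ F2

def ximon {Y : Type} (n : Y →₀ ℕ) : XiX Y := Finsupp.single n 1

def xiMul {Y : Type} [DecidableEq Y] (y : Y) : XiX Y →ₗ[F2] XiX Y :=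
  Finsupp.lsum F2 fun n =>
    if n y = 0 then (0 : F2 →ₗ[F2] XiX Y)
    else Finsupp.lsingle (n - Finsupp.single y 1)

def IsBddAboveComplex (C : Type) [AddCommGroup C] [Module F2 C]
    (d : C →ₗ[F2] C) : Prop :=
  d.comp d = 0 ∧
  ∃ Cdeg : ℤ → Submodule F2 C,
    DirectSum.IsInternal Cdeg ∧
    (∃ N : ℤ, ∀ n : ℤ, N < n → Cdeg n = ⊥) ∧
    ∀ n : ℤ, ∀ c ∈ Cdeg n, d c ∈ Cdeg (n + 1)

variable (Y : Type) [Fintype Y] [DecidableEq Y]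
variable (C : Type) [AddCommGroup C] [Module F2 C]

/-- The preferred free resolution `C̄_Y = (R_Y ⊗ Ξ_Y) ⊗ C`. -/
abbrev CbarY : Type := (Rgen Y ⊗[F2] XiX Y) ⊗[F2] C

/-- The differential of the preferred free resolution of `(C, d, act)` over `R_Y`:
`∂_C⊗1⊗1 + Σ_y (act(y)⊗1 + 1⊗y)⊗ξ_y`. -/
def delBar (d : C →ₗ[F2] C) (act : Y → C →ₗ[F2] C) : CbarY Y C →ₗ[F2] CbarY Y C :=
  TensorProduct.map LinearMap.id d +
    ∑ y : Y,
      (TensorProduct.map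
          (TensorProduct.map (LinearMap.mulLeft F2 (rgen y)) (xiMul y)) LinearMap.id +
        TensorProduct.map (TensorProduct.map LinearMap.id (xiMul y)) (act y))

/-- Multiplication by `r ∈ R_Y` on the middle factor of `C̄_Y`. -/
def midMul (r : Rgen Y) : CbarY Y C →ₗ[F2] CbarY Y C :=
  TensorProduct.map
    (TensorProduct.map (LinearMap.mulLeft F2 r) LinearMap.id) LinearMap.id


section GeneratorAlgebra

variable {V : Type}

theorem rgen_mul_self (y : V) : rgen y * rgen y = 0 := by
  rw [rgen, ← map_mul, ← pow_two, Ideal.Quotient.eq_zero_iff_mem]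
  exact Ideal.subset_span ⟨y, rfl⟩

/-- The universal property of `Rgen V`: square-zero elements extend to an algebra map. -/
def rgenLift {A : Type} [CommRing A] [Algebra F2 A] (f : V → A) (hf : ∀ y, f y * f y = 0) :
    Rgen V →ₐ[F2] A :=
  Ideal.Quotient.liftₐ _ (MvPolynomial.aeval f) (by
    intro a ha
    have hle : Ideal.span (Set.range fun y : V => (MvPolynomial.X y : MvPolynomial V F2) ^ 2) ≤
        RingHom.ker (MvPolynomial.aeval f : MvPolynomial V F2 →ₐ[F2] A) := by
      rw [Ideal.span_le]
      rintro _ ⟨y, rfl⟩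
      simp [RingHom.mem_ker, pow_two, hf]
    exact hle ha)

@[simp]
theorem rgenLift_rgen {A : Type} [CommRing A] [Algebra F2 A] (f : V → A)
    (hf : ∀ y, f y * f y = 0) (y : V) : rgenLift f hf (rgen y) = f y :=
  (Ideal.Quotient.liftₐ_apply _ _ _ _).trans (MvPolynomial.aeval_X f y)

theorem rgen_induction {p : Rgen V → Prop} (h0 : p 0) (h1 : p 1)
    (hadd : ∀ r s, p r → p s → p (r + s)) (hmul : ∀ y r, p r → p (rgen y * r)) (r : Rgen V) :
    p r := by
  obtain ⟨f, rfl⟩ := Ideal.Quotient.mk_surjective r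
  induction f using MvPolynomial.induction_on with
  | C a =>
    obtain rfl | rfl : a = 0 ∨ a = 1 := by revert a; decide
    · simpa using h0
    · simpa using h1
  | add f g hf hg => rw [map_add]; exact hadd _ _ hf hg
  | mul_X f y hf => rw [map_mul, mul_comm]; exact hmul _ _ hf

theorem rgen_algHom_ext {A : Type} [Semiring A] [Algebra F2 A] {f g : Rgen V →ₐ[F2] A}
    (h : ∀ y, f (rgen y) = g (rgen y)) : f = g := by
  ext r
  induction r using rgen_induction with
  | h0 => simp
  | h1 => simp
  | hadd r s hr hs => simp only [map_add, hr, hs]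
  | hmul y r hr => simp only [map_mul, h, hr]

theorem F2_add_self {M : Type} [AddCommGroup M] [Module F2 M] (x : M) : x + x = 0 := by
  rw [← two_smul F2 x, show (2 : F2) = 0 from rfl, zero_smul]

/-- The augmentation of `Rgen V`. -/
def rgenAug : Rgen V →ₐ[F2] F2 := rgenLift (fun _ => 0) (by simp)

variable [DecidableEq V]

/-- `r ↦ r + (∂r/∂y) ε`, with values in the dual numbers. -/
def rgenTaylor (y : V) : Rgen V →ₐ[F2] TrivSqZeroExt (Rgen V) (Rgen V) :=
  rgenLift (fun z => TrivSqZeroExt.inl (rgen z) + TrivSqZeroExt.inr (if z = y then (1 : Rgen V) else 0)) (by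
    intro z
    split_ifs <;> ext <;> simp [rgen_mul_self, F2_add_self])

theorem fst_rgenTaylor (y : V) (r : Rgen V) : (rgenTaylor y r).fst = r := by
  have h : (TrivSqZeroExt.fstHom F2 (Rgen V) (Rgen V)).comp (rgenTaylor y) =
      AlgHom.id F2 (Rgen V) := rgen_algHom_ext fun z => by
      simp only [AlgHom.comp_apply, rgenTaylor, rgenLift_rgen]
      split_ifs <;> simp
  exact DFunLike.congr_fun h r

/-- The partial derivative `∂/∂y` on `Rgen V`. -/
def rgenDeriv (y : V) : Rgen V →ₗ[F2] Rgen V :=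
  (TrivSqZeroExt.sndHom (Rgen V) (Rgen V)).restrictScalars F2 ∘ₗ (rgenTaylor y).toLinearMap

@[simp]
theorem rgenDeriv_one (y : V) : rgenDeriv y 1 = 0 := by
  simp [rgenDeriv]

theorem rgenDeriv_rgen_mul (y z : V) (r : Rgen V) :
    rgenDeriv y (rgen z * r) = rgen z * rgenDeriv y r + if z = y then r else 0 := by
  have h : (rgenTaylor y (rgen z)).snd = if z = y then 1 else 0 := by
    simp only [rgenTaylor, rgenLift_rgen]
    split_ifs <;> simp
  simp only [rgenDeriv, LinearMap.comp_apply, AlgHom.toLinearMap_apply,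
    LinearMap.restrictScalars_apply, TrivSqZeroExt.sndHom_apply, map_mul,
    TrivSqZeroExt.snd_mul, fst_rgenTaylor, h]
  split_ifs <;> simp

theorem rgenDeriv_comm (y z : V) (r : Rgen V) :
    rgenDeriv y (rgenDeriv z r) = rgenDeriv z (rgenDeriv y r) := by
  induction r using rgen_induction with
  | h0 => simp
  | h1 => simp
  | hadd r s hr hs => simp only [map_add, hr, hs]
  | hmul x r hr =>
    simp only [rgenDeriv_rgen_mul, map_add, hr]
    split_ifs <;> simp [add_comm, add_left_comm]

theorem rgenDeriv_self (y : V) (r : Rgen V) : rgenDeriv y (rgenDeriv y r) = 0 := by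
  induction r using rgen_induction with
  | h0 => simp
  | h1 => simp
  | hadd r s hr hs => simp only [map_add, hr, hs, add_zero]
  | hmul x r hr =>
    simp only [rgenDeriv_rgen_mul, map_add, hr]
    split_ifs <;> simp [F2_add_self]

end GeneratorAlgebra

section DividedPowers

variable {V : Type}

theorem xiX_ext {N : Type} [AddCommGroup N] [Module F2 N] {f g : XiX V →ₗ[F2] N}
    (h : ∀ n, f (ximon n) = g (ximon n)) : f = g :=
  Finsupp.lhom_ext' fun n => LinearMap.ext_ring (h n)

/-- Raising the exponent of `y`, a right inverse of `xiMul y`. -/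
def xiRaise (y : V) : XiX V →ₗ[F2] XiX V :=
  Finsupp.lmapDomain F2 F2 fun n => n + Finsupp.single y 1

theorem xiRaise_ximon (y : V) (n : V →₀ ℕ) :
    xiRaise y (ximon n) = ximon (n + Finsupp.single y 1) := by
  simp [xiRaise, ximon]

theorem xiRaise_comm (y z : V) : xiRaise y * xiRaise z = xiRaise z * xiRaise y := by
  refine xiX_ext fun n => ?_
  simp [xiRaise_ximon, add_right_comm]

variable [DecidableEq V]

theorem xiMul_ximon (y : V) (n : V →₀ ℕ) :
    xiMul y (ximon n) = if n y = 0 then 0 else ximon (n - Finsupp.single y 1) := by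
  rw [xiMul, ximon, Finsupp.lsum_single]
  split_ifs <;> simp [ximon]

theorem xiMul_apply (y : V) (v : XiX V) (m : V →₀ ℕ) :
    xiMul y v m = v (m + Finsupp.single y 1) := by
  have h : Finsupp.lapply m ∘ₗ xiMul y =
      (Finsupp.lapply (m + Finsupp.single y 1) : XiX V →ₗ[F2] F2) := by
    refine xiX_ext fun n => ?_
    simp only [LinearMap.comp_apply, xiMul_ximon, Finsupp.lapply_apply]
    by_cases hn : n y = 0
    · have hne : n ≠ m + Finsupp.single y 1 := by rintro rfl; simp at hn
      simp [hn, ximon, hne]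
    · have hle : Finsupp.single y 1 ≤ n := by
        rw [Finsupp.single_le_iff]; omega
      have hiff : n - Finsupp.single y 1 = m ↔ n = m + Finsupp.single y 1 :=
        tsub_eq_iff_eq_add_of_le hle
      simp [hn, ximon, Finsupp.single_apply, hiff]
  exact DFunLike.congr_fun h v

theorem xiMul_comm (y z : V) (v : XiX V) : xiMul y (xiMul z v) = xiMul z (xiMul y v) := by
  ext m
  simp only [xiMul_apply, add_right_comm]

/-- The projection onto the span of the monomials in which `y` does not occur. -/
def xiProj (y : V) : XiX V →ₗ[F2] XiX V := 1 + xiRaise y * xiMul y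

theorem xiProj_ximon (y : V) (n : V →₀ ℕ) :
    xiProj y (ximon n) = if n y = 0 then ximon n else 0 := by
  simp only [xiProj, LinearMap.add_apply, Module.End.one_apply, Module.End.mul_apply, xiMul_ximon]
  split_ifs with hn
  · simp
  · have hle : Finsupp.single y 1 ≤ n := by
      rw [Finsupp.single_le_iff]; omega
    rw [xiRaise_ximon, tsub_add_cancel_of_le hle, F2_add_self]

theorem xiMul_xiRaise (y : V) : xiMul y * xiRaise y = 1 := by
  refine xiX_ext fun n => ?_
  simp [xiRaise_ximon, xiMul_ximon]

theorem xiMul_xiRaise_comm {y z : V} (h : y ≠ z) :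
    xiMul y * xiRaise z = xiRaise z * xiMul y := by
  refine xiX_ext fun n => ?_
  have hz : Finsupp.single z 1 y = 0 := by simp [h.symm]
  simp only [Module.End.mul_apply, xiRaise_ximon, xiMul_ximon, Finsupp.add_apply, hz, add_zero]
  split_ifs with hn
  · simp
  · have hle : Finsupp.single y 1 ≤ n := by
      rw [Finsupp.single_le_iff]; omega
    rw [xiRaise_ximon, tsub_add_eq_add_tsub hle]

end DividedPowers

section Contraction

/-- Pairwise commuting contractions of commuting square-zero elements of a ring of
characteristic two assemble to a contraction of their sum. -/
theorem exists_contraction_of_commute {ι A : Type} [Ring A] (h2 : ∀ x : A, x + x = 0)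
    (a s p : ι → A) (hp : ∀ i, a i * s i + s i * a i = 1 + p i) (ha : ∀ i, a i * a i = 0)
    (haa : ∀ i j, i ≠ j → Commute (a i) (a j)) (has : ∀ i j, i ≠ j → Commute (a i) (s j))
    (hss : ∀ i j, i ≠ j → Commute (s i) (s j)) (l : List ι) (hl : l.Nodup) :
    ∃ S : A, (∀ c, (∀ i ∈ l, Commute c (a i) ∧ Commute c (s i)) → Commute c S) ∧
      (l.map a).sum * S + S * (l.map a).sum = 1 + (l.map p).prod := by
  have hp' : ∀ i, p i = a i * s i + s i * a i + 1 := fun i => by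
    rw [hp i, add_comm 1, add_assoc, h2, add_zero]
  have hcp : ∀ c i, Commute c (a i) → Commute c (s i) → Commute c (p i) := fun c i h h' => by
    rw [hp' i]
    exact ((h.mul_right h').add_right (h'.mul_right h)).add_right (Commute.one_right c)
  have hap : ∀ i j, Commute (a i) (p j) := fun i j => by
    by_cases hij : i = j
    · subst hij
      have h1 : a i * (s i * a i) = a i * s i * a i := (mul_assoc _ _ _).symm
      have h3 : a i * (a i * s i) = 0 := by rw [← mul_assoc, ha, zero_mul]
      have h4 : s i * a i * a i = 0 := by rw [mul_assoc, ha, mul_zero]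
      rw [hp' i, commute_iff_eq]
      simp only [mul_add, add_mul, h1, h3, h4, mul_one, one_mul, add_zero, zero_add]
    · exact hcp _ _ (haa i j hij) (has i j hij)
  induction l with
  | nil => exact ⟨0, by simp, by simp [h2]⟩
  | cons i l ih =>
    obtain ⟨hi, hl⟩ := List.nodup_cons.1 hl
    obtain ⟨S, hS, hSl⟩ := ih hl
    have hne : ∀ j ∈ l, i ≠ j := fun j hj h => hi (h ▸ hj)
    set d := (l.map a).sum
    set P := (l.map p).prod
    have hPc : ∀ c, (∀ j ∈ l, Commute c (p j)) → Commute c P := fun c hc =>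
      Commute.list_prod_right _ _ (by simpa using hc)
    have hdc : ∀ c, (∀ j ∈ l, Commute c (a j)) → Commute c d := fun c hc =>
      Commute.list_sum_right _ _ (by simpa using hc)
    have haS : Commute (a i) S := hS _ fun j hj => ⟨haa _ _ (hne j hj), has _ _ (hne j hj)⟩
    have haP : Commute (a i) P := hPc _ fun j _ => hap i j
    have hsP : Commute (s i) P := hPc _ fun j hj =>
      hcp _ _ (has j i (hne j hj).symm).symm (hss _ _ (hne j hj))
    have hsd : Commute (s i) d := hdc _ fun j hj => (has j i (hne j hj).symm).symm
    have hdP : Commute d P := (hdc P fun j _ => (hPc _ fun k _ => hap j k).symm).symm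
    have hpP : Commute (p i) P := by
      rw [hp' i]
      exact ((haP.mul_left hsP).add_left (hsP.mul_left haP)).add_left (Commute.one_left P)
    refine ⟨S + P * s i, fun c hc => ?_, ?_⟩
    · refine (hS c fun j hj => hc j (by simp [hj])).add_right ?_
      have hci := hc i (by simp)
      refine Commute.mul_right (hPc c fun j hj => ?_) hci.2
      exact hcp _ _ (hc j (by simp [hj])).1 (hc j (by simp [hj])).2
    · simp only [List.map_cons, List.sum_cons, List.prod_cons]
      change (a i + d) * (S + P * s i) + (S + P * s i) * (a i + d) = 1 + p i * P
      have e1 : a i * S = S * a i := haS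
      have e2 : a i * (P * s i) = P * (a i * s i) := by
        rw [← mul_assoc, haP.eq, mul_assoc]
      have e3 : d * (P * s i) = P * s i * d := by
        rw [← mul_assoc, hdP.eq, mul_assoc, mul_assoc, hsd.eq]
      have e4 : P * s i * a i = P * (s i * a i) := mul_assoc _ _ _
      calc (a i + d) * (S + P * s i) + (S + P * s i) * (a i + d)
          = (S * a i + S * a i) + (P * s i * d + P * s i * d) + (d * S + S * d) +
              P * (a i * s i + s i * a i) := by
            simp only [mul_add, add_mul, e1, e2, e3, e4]; abel
        _ = 1 + (P + P) + P * p i := by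
            rw [h2, h2, hSl, hp i, mul_add, mul_one]; abel
        _ = 1 + p i * P := by rw [h2, add_zero, hpP.eq]

/-- An exact complex of free modules that is bounded on one side is contractible. -/
theorem exists_linear_contraction {R M ι : Type} [CommRing R] [AddCommGroup M] [Module R M]
    (b : Module.Basis ι R M) (deg : ι → ℕ) (D : M →ₗ[R] M) (hDD : ∀ x, D (D x) = 0)
    (hex : ∀ x, D x = 0 → ∃ y, D y = x)
    (hdeg : ∀ i, D (b i) ∈ Submodule.span R (b '' {j | deg j < deg i})) :
    ∃ h : M →ₗ[R] M, ∀ x, D (h x) + h (D x) = x := by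
  classical
  choose! s hs using hex
  let F : ℕ → Submodule R M := fun k => Submodule.span R (b '' {j | deg j < k})
  have hF : Monotone F := fun k l hkl =>
    Submodule.span_mono (Set.image_mono fun j (hj : deg j < k) => hj.trans_le hkl)
  have hFeq : ∀ (k : ℕ) (u v : M →ₗ[R] M), (∀ i, deg i < k → u (b i) = v (b i)) →
      ∀ x ∈ F k, u x = v x := fun k u v huv x hx => by
    refine LinearMap.eqOn_span (f := u) (g := v) ?_ hx
    rintro _ ⟨i, hi, rfl⟩
    exact huv i hi
  let h : ℕ → M →ₗ[R] M := fun k =>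
    Nat.rec 0 (fun _ hk => b.constr R fun i => s (b i - hk (D (b i)))) k
  have hsucc : ∀ k i, h (k + 1) (b i) = s (b i - h k (D (b i))) := fun k i =>
    b.constr_basis R _ i
  have hstab : ∀ k, ∀ x ∈ F k, h (k + 1) x = h k x := by
    intro k
    induction k with
    | zero => exact hFeq 0 _ _ fun i hi => absurd hi (Nat.not_lt_zero _)
    | succ k ih =>
      refine hFeq _ _ _ fun i hi => ?_
      rw [hsucc (k + 1), hsucc k, ih _ (hF (Nat.lt_succ_iff.1 hi) (hdeg i))]
  have hstab' : ∀ k l, k ≤ l → ∀ x ∈ F k, h l x = h k x := fun k l hkl => by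
    induction l, hkl using Nat.le_induction with
    | base => exact fun x _ => rfl
    | succ l hl ih => exact fun x hx => (hstab l x (hF hl hx)).trans (ih x hx)
  have hcontr : ∀ k, ∀ x ∈ F k, D (h k x) + h k (D x) = x := by
    intro k
    induction k with
    | zero =>
      exact hFeq 0 (D ∘ₗ h 0 + h 0 ∘ₗ D) LinearMap.id fun i hi => absurd hi (Nat.not_lt_zero _)
    | succ k ih =>
      refine hFeq _ (D ∘ₗ h (k + 1) + h (k + 1) ∘ₗ D) LinearMap.id fun i hi => ?_
      have hmem := hF (Nat.lt_succ_iff.1 hi) (hdeg i)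
      have hcyc : D (b i - h k (D (b i))) = 0 := by
        have := ih _ hmem
        rw [hDD, map_zero, add_zero] at this
        rw [map_sub, this, sub_self]
      simp only [LinearMap.add_apply, LinearMap.comp_apply, LinearMap.id_apply]
      rw [hsucc, hs _ hcyc, hstab _ _ hmem, sub_add_cancel]
  refine ⟨b.constr R fun i => h (deg i + 1) (b i), fun x => ?_⟩
  set H := b.constr R fun i => h (deg i + 1) (b i)
  have hH : ∀ k, ∀ x ∈ F k, H x = h k x := fun k => hFeq _ _ _ fun i hi => by
    refine (b.constr_basis R _ i).trans (hstab' _ _ hi _ ?_).symm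
    exact Submodule.subset_span ⟨i, Nat.lt_succ_self _, rfl⟩
  have hid : D ∘ₗ H + H ∘ₗ D = LinearMap.id := b.ext fun i => by
    have hi : b i ∈ F (deg i + 1) := Submodule.subset_span ⟨i, Nat.lt_succ_self _, rfl⟩
    have hDi : D (b i) ∈ F (deg i + 1) := hF (Nat.le_succ _) (hdeg i)
    simp only [LinearMap.add_apply, LinearMap.comp_apply, LinearMap.id_apply]
    rw [hH _ _ hi, hH _ _ hDi, hcontr _ _ hi]
  exact DFunLike.congr_fun hid x

/-- In characteristic two, a chain map between free complexes bounded on one side whose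
mapping cone is exact has a homotopy inverse. -/
theorem exists_homotopy_inverse {R P Q ι κ : Type} [CommRing R] [AddCommGroup P] [Module R P]
    [AddCommGroup Q] [Module R Q] (hP : ∀ x : P, x + x = 0) (hQ : ∀ x : Q, x + x = 0)
    (b : Module.Basis ι R P) (c : Module.Basis κ R Q) (degP : ι → ℕ) (degQ : κ → ℕ)
    (dP : P →ₗ[R] P) (dQ : Q →ₗ[R] Q) (f : P →ₗ[R] Q)
    (hdP : ∀ x, dP (dP x) = 0) (hdQ : ∀ x, dQ (dQ x) = 0) (hf : ∀ x, f (dP x) = dQ (f x))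
    (hex : ∀ x y, dP x = 0 → f x + dQ y = 0 → ∃ x' y', dP x' = x ∧ f x' + dQ y' = y)
    (hdegP : ∀ i, dP (b i) ∈ Submodule.span R (b '' {j | degP j < degP i}))
    (hdegQ : ∀ i, dQ (c i) ∈ Submodule.span R (c '' {j | degQ j < degQ i}))
    (hdegf : ∀ i, f (b i) ∈ Submodule.span R (c '' {j | degQ j < degP i + 1})) :
    ∃ (g : Q →ₗ[R] P) (h : P →ₗ[R] P) (k : Q →ₗ[R] Q),
      (∀ x, g (dQ x) = dP (g x)) ∧ (∀ x, dP (h x) + h (dP x) = g (f x) + x) ∧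
        ∀ x, dQ (k x) + k (dQ x) = f (g x) + x := by
  let D : P × Q →ₗ[R] P × Q :=
    (dP ∘ₗ LinearMap.fst R P Q).prod (f ∘ₗ LinearMap.fst R P Q + dQ ∘ₗ LinearMap.snd R P Q)
  have hD : ∀ x y, D (x, y) = (dP x, f x + dQ y) := fun _ _ => rfl
  let deg : ι ⊕ κ → ℕ := Sum.elim (fun i => degP i + 1) degQ
  have hinl : ∀ i x, x ∈ Submodule.span R (b '' {j | degP j < degP i}) →
      ((x, 0) : P × Q) ∈ Submodule.span R (b.prod c '' {j | deg j < degP i + 1}) := by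
    intro i x hx
    have := Submodule.mem_map_of_mem (f := LinearMap.inl R P Q) hx
    rw [Submodule.map_span] at this
    refine Submodule.span_mono ?_ this
    rintro _ ⟨_, ⟨j, hj, rfl⟩, rfl⟩
    exact ⟨Sum.inl j, by simpa [deg] using hj, by simp⟩
  have hinr : ∀ k x, x ∈ Submodule.span R (c '' {j | degQ j < k}) →
      ((0, x) : P × Q) ∈ Submodule.span R (b.prod c '' {j | deg j < k}) := by
    intro k x hx
    have := Submodule.mem_map_of_mem (f := LinearMap.inr R P Q) hx
    rw [Submodule.map_span] at this
    refine Submodule.span_mono ?_ this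
    rintro _ ⟨_, ⟨j, hj, rfl⟩, rfl⟩
    exact ⟨Sum.inr j, by simpa [deg] using hj, by simp⟩
  obtain ⟨h, hh⟩ := exists_linear_contraction (b.prod c) deg D
    (by
      rintro ⟨x, y⟩
      simp [hD, hdP, hdQ, hf, hQ])
    (by
      rintro ⟨x, y⟩ hxy
      rw [hD, Prod.mk_eq_zero] at hxy
      obtain ⟨x', y', hx', hy'⟩ := hex x y hxy.1 hxy.2
      exact ⟨(x', y'), by rw [hD, hx', hy']⟩)
    (by
      rintro (i | i)
      · have hsplit : D (b.prod c (Sum.inl i)) = (dP (b i), 0) + (0, f (b i)) := by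
          simp [D]
        rw [hsplit]
        exact add_mem (hinl i _ (hdegP i)) (hinr _ _ (hdegf i))
      · have hsplit : D (b.prod c (Sum.inr i)) = (0, dQ (c i)) := by
          simp [D]
        rw [hsplit]
        exact hinr _ _ (hdegQ i))
  have hl : ∀ x, D (h (x, 0)) + (h (dP x, 0) + h (0, f x)) = (x, 0) := fun x => by
    have hsplit : D (x, 0) = (dP x, 0) + (0, f x) := by simp [hD]
    rw [← map_add, ← hsplit, hh]
  have hr : ∀ y, D (h (0, y)) + h (0, dQ y) = (0, y) := fun y => by
    have hsplit : D (0, y) = (0, dQ y) := by simp [hD]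
    rw [← hsplit, hh]
  refine ⟨LinearMap.fst R P Q ∘ₗ h ∘ₗ LinearMap.inr R P Q,
    LinearMap.fst R P Q ∘ₗ h ∘ₗ LinearMap.inl R P Q,
    LinearMap.snd R P Q ∘ₗ h ∘ₗ LinearMap.inr R P Q, fun y => ?_, fun x => ?_, fun y => ?_⟩
  · have e : dP (h (0, y)).1 + (h (0, dQ y)).1 = 0 := congrArg Prod.fst (hr y)
    exact (eq_neg_of_add_eq_zero_right e).trans (neg_eq_of_add_eq_zero_right (hP _))
  · have e : dP (h (x, 0)).1 + ((h (dP x, 0)).1 + (h (0, f x)).1) = x :=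
      congrArg Prod.fst (hl x)
    calc dP (h (x, 0)).1 + (h (dP x, 0)).1
        = (h (0, f x)).1 + (h (0, f x)).1 + (dP (h (x, 0)).1 + (h (dP x, 0)).1) := by
          rw [hP, zero_add]
      _ = (h (0, f x)).1 + (dP (h (x, 0)).1 + ((h (dP x, 0)).1 + (h (0, f x)).1)) := by abel
      _ = (h (0, f x)).1 + x := by rw [e]
  · have e : f (h (0, y)).1 + dQ (h (0, y)).2 + (h (0, dQ y)).2 = y := congrArg Prod.snd (hr y)
    calc dQ (h (0, y)).2 + (h (0, dQ y)).2
        = f (h (0, y)).1 + f (h (0, y)).1 + (dQ (h (0, y)).2 + (h (0, dQ y)).2) := by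
          rw [hQ, zero_add]
      _ = f (h (0, y)).1 + (f (h (0, y)).1 + dQ (h (0, y)).2 + (h (0, dQ y)).2) := by abel
      _ = f (h (0, y)).1 + y := by rw [e]

end Contraction

section Koszul

theorem sum_mul_self_eq_zero {ι A : Type} [Ring A] (h2 : ∀ x : A, x + x = 0) (a : ι → A)
    (ha : ∀ i, a i * a i = 0) (hc : ∀ i j, Commute (a i) (a j)) (T : Finset ι) :
    (∑ i ∈ T, a i) * ∑ i ∈ T, a i = 0 := by
  classical
  induction T using Finset.induction_on with
  | empty => simp
  | insert i T hi ih =>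
    have hcomm : Commute (a i) (∑ j ∈ T, a j) := Commute.sum_right _ _ _ fun j _ => hc i j
    rw [Finset.sum_insert hi, mul_add, add_mul, add_mul, ha, ih, hcomm.eq, zero_add, add_zero, h2]

variable (V : Type) [Fintype V] [DecidableEq V]

/-- The Koszul complex `F_V`, with differential `∑ y ⊗ ξ_y`. -/
def koszul : Rgen V ⊗[F2] XiX V →ₗ[Rgen V] Rgen V ⊗[F2] XiX V :=
  ∑ y : V, TensorProduct.AlgebraTensorModule.map (LinearMap.mulLeft (Rgen V) (rgen y)) (xiMul y)

/-- The augmentation of the Koszul complex. -/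
def koszulAug : Rgen V ⊗[F2] XiX V →ₗ[F2] F2 :=
  LinearMap.mul' F2 F2 ∘ₗ TensorProduct.map rgenAug.toLinearMap (Finsupp.lapply 0)

variable {V}

theorem koszul_tmul (r : Rgen V) (v : XiX V) :
    koszul V (r ⊗ₜ v) = ∑ y, (rgen y * r) ⊗ₜ xiMul y v := by
  simp only [koszul, LinearMap.sum_apply, TensorProduct.AlgebraTensorModule.map_tmul,
    LinearMap.mulLeft_apply]

omit [Fintype V] [DecidableEq V] in
theorem koszulAug_tmul (r : Rgen V) (v : XiX V) : koszulAug V (r ⊗ₜ v) = rgenAug r * v 0 := rfl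

/-- The summand of the Koszul differential at one color. -/
def koszulTerm {V : Type} [DecidableEq V] (y : V) : Module.End F2 (Rgen V ⊗[F2] XiX V) :=
  TensorProduct.map (LinearMap.mulLeft F2 (rgen y)) (xiMul y)

theorem koszul_restrictScalars :
    (koszul V).restrictScalars F2 = ∑ y, koszulTerm y := by
  refine TensorProduct.ext' fun r v => ?_
  simp only [LinearMap.restrictScalars_apply, koszul_tmul, LinearMap.sum_apply, koszulTerm,
    TensorProduct.map_tmul, LinearMap.mulLeft_apply]

theorem koszul_apply (z : Rgen V ⊗[F2] XiX V) :
    koszul V z = (∑ y, koszulTerm y) z :=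
  DFunLike.congr_fun koszul_restrictScalars z

omit [Fintype V] in
theorem koszulTerm_mul_self (y : V) : koszulTerm y * koszulTerm y = 0 := by
  refine TensorProduct.ext' fun r v => ?_
  simp [koszulTerm, ← mul_assoc, rgen_mul_self]

omit [Fintype V] in
theorem koszulTerm_comm (y z : V) : Commute (koszulTerm y) (koszulTerm z) := by
  refine TensorProduct.ext' fun r v => ?_
  simp [koszulTerm, xiMul_comm y z, mul_left_comm]

theorem koszul_koszul (z : Rgen V ⊗[F2] XiX V) : koszul V (koszul V z) = 0 := by
  rw [koszul_apply, koszul_apply]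
  exact DFunLike.congr_fun (sum_mul_self_eq_zero (fun x => F2_add_self x) (koszulTerm (V := V))
    koszulTerm_mul_self koszulTerm_comm _) z

theorem koszulAug_koszul (z : Rgen V ⊗[F2] XiX V) : koszulAug V (koszul V z) = 0 := by
  induction z using TensorProduct.induction_on with
  | zero => simp
  | tmul r v => simp [koszul_tmul, koszulAug_tmul, rgenAug]
  | add z w hz hw => rw [map_add, map_add, hz, hw, add_zero]

theorem koszul_one : koszul V (1 ⊗ₜ ximon 0) = 0 := by
  simp [koszul_tmul, xiMul_ximon]

/-- The contraction of the Koszul complex in the direction of one color. -/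
def koszulContract {V : Type} [DecidableEq V] (y : V) : Module.End F2 (Rgen V ⊗[F2] XiX V) :=
  TensorProduct.map (rgenDeriv y) (xiRaise y)

variable {V : Type} [DecidableEq V]

theorem koszulTerm_koszulContract (y : V) :
    koszulTerm y * koszulContract y + koszulContract y * koszulTerm y =
      1 + TensorProduct.map (rgenDeriv y ∘ₗ LinearMap.mulLeft F2 (rgen y)) (xiProj y) := by
  refine TensorProduct.ext' fun r v => ?_
  have h1 : xiMul y (xiRaise y v) = v := DFunLike.congr_fun (xiMul_xiRaise y) v
  have h2 : xiRaise y (xiMul y v) = v + xiProj y v := by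
    simp [xiProj, ← add_assoc, F2_add_self]
  have h3 : ∀ a b : Rgen V ⊗[F2] XiX V, a + (a + b) = b := fun a b => by
    rw [← add_assoc, F2_add_self, zero_add]
  simp only [koszulTerm, koszulContract, LinearMap.add_apply, Module.End.mul_apply,
    Module.End.one_apply, TensorProduct.map_tmul, LinearMap.mulLeft_apply, LinearMap.comp_apply,
    rgenDeriv_rgen_mul, h1, h2, if_true, TensorProduct.tmul_add, TensorProduct.add_tmul]
  rw [add_assoc, h3]

theorem koszulTerm_koszulContract_comm {y z : V} (h : y ≠ z) :
    Commute (koszulTerm y) (koszulContract z) := by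
  refine TensorProduct.ext' fun r v => ?_
  have h1 : xiMul y (xiRaise z v) = xiRaise z (xiMul y v) :=
    DFunLike.congr_fun (xiMul_xiRaise_comm h) v
  simp [koszulTerm, koszulContract, rgenDeriv_rgen_mul, h, h1]

theorem koszulContract_comm (y z : V) :
    Commute (koszulContract y) (koszulContract z) := by
  refine TensorProduct.ext' fun r v => ?_
  have h1 : xiRaise y (xiRaise z v) = xiRaise z (xiRaise y v) :=
    DFunLike.congr_fun (xiRaise_comm y z) v
  simp [koszulContract, rgenDeriv_comm y z, h1]

theorem koszulProj_list_tmul (l : List V) (r : Rgen V) (n : V →₀ ℕ) :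
    ((l.map fun y => TensorProduct.map (rgenDeriv y ∘ₗ LinearMap.mulLeft F2 (rgen y))
      (xiProj y)).prod : Module.End F2 (Rgen V ⊗[F2] XiX V)) (r ⊗ₜ ximon n) =
      ((l.map fun y => rgenDeriv y ∘ₗ LinearMap.mulLeft F2 (rgen y)).prod :
        Module.End F2 (Rgen V)) r ⊗ₜ if ∀ y ∈ l, n y = 0 then ximon n else 0 := by
  induction l with
  | nil => simp
  | cons y l ih =>
    simp only [List.map_cons, List.prod_cons, Module.End.mul_apply, ih, TensorProduct.map_tmul,
      List.forall_mem_cons]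
    congr 1
    by_cases hl : ∀ z ∈ l, n z = 0
    · simp only [if_pos hl, xiProj_ximon, and_iff_left hl]
    · rw [if_neg hl, if_neg fun h => hl h.2, map_zero]

theorem rgenProj_list_mul (l : List V) (y : V) (hy : y ∈ l) (r : Rgen V) :
    ((l.map fun y => rgenDeriv y ∘ₗ LinearMap.mulLeft F2 (rgen y)).prod :
        Module.End F2 (Rgen V)) (rgen y * r) = 0 := by
  induction l generalizing r with
  | nil => simp at hy
  | cons z l ih =>
    simp only [List.map_cons, List.prod_cons, Module.End.mul_apply]
    by_cases hyl : y ∈ l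
    · rw [ih hyl, map_zero]
    · obtain rfl : y = z := by simpa [hyl] using hy
      have hcomm : Commute (LinearMap.mulLeft F2 (rgen y))
          (l.map fun y => rgenDeriv y ∘ₗ LinearMap.mulLeft F2 (rgen y)).prod := by
        refine Commute.list_prod_right _ _ fun f hf => ?_
        obtain ⟨x, hx, rfl⟩ := List.mem_map.1 hf
        have hne : y ≠ x := fun h => hyl (h ▸ hx)
        refine LinearMap.ext fun s => ?_
        simp [mul_left_comm (rgen x) (rgen y), rgenDeriv_rgen_mul x y, hne]
      have := DFunLike.congr_fun hcomm.eq r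
      simp only [Module.End.mul_apply, LinearMap.mulLeft_apply] at this
      rw [← this]
      simp [← mul_assoc, rgen_mul_self]

theorem rgenProj_list_apply (l : List V) (hl : ∀ y, y ∈ l) (r : Rgen V) :
    ((l.map fun y => rgenDeriv y ∘ₗ LinearMap.mulLeft F2 (rgen y)).prod :
        Module.End F2 (Rgen V)) r = rgenAug r • (1 : Rgen V) := by
  induction r using rgen_induction with
  | h0 => simp
  | h1 =>
    rw [map_one rgenAug, one_smul]
    clear hl
    induction l with
    | nil => simp
    | cons y l ih =>
      have : rgenDeriv y (rgen y * 1) = 1 := by simp only [rgenDeriv_rgen_mul]; simp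
      simp only [List.map_cons, List.prod_cons, Module.End.mul_apply, ih, LinearMap.comp_apply,
        LinearMap.mulLeft_apply, this]
  | hadd r s hr hs => rw [map_add, map_add, add_smul, hr, hs]
  | hmul y r hr => simp [rgenProj_list_mul l y (hl y), rgenAug]

variable [Fintype V]

theorem exists_koszul_contraction :
    ∃ S : Rgen V ⊗[F2] XiX V → Rgen V ⊗[F2] XiX V, ∀ z, koszul V z = 0 →
      koszul V (S z) = z + koszulAug V z • (1 ⊗ₜ ximon 0) := by
  obtain ⟨S, -, hS⟩ := exists_contraction_of_commute (fun x => F2_add_self x) koszulTerm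
    koszulContract _ koszulTerm_koszulContract koszulTerm_mul_self
    (fun y z _ => koszulTerm_comm y z) (fun _ _ h => koszulTerm_koszulContract_comm h)
    (fun y z _ => koszulContract_comm y z) (Finset.univ : Finset V).toList
    (Finset.nodup_toList _)
  rw [Finset.sum_map_toList] at hS
  refine ⟨S, fun z hz => ?_⟩
  have h := DFunLike.congr_fun hS z
  rw [koszul_apply] at hz ⊢
  simp only [LinearMap.add_apply, Module.End.mul_apply, hz, map_zero, add_zero,
    Module.End.one_apply] at h
  rw [h]
  congr 1
  refine DFunLike.congr_fun (f := ((_ : Module.End F2 (Rgen V ⊗[F2] XiX V))))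
    (g := (koszulAug V).smulRight ((1 : Rgen V) ⊗ₜ[F2] ximon (0 : V →₀ ℕ))) ?_ z
  refine TensorProduct.ext (LinearMap.ext fun r => xiX_ext fun n => ?_)
  refine (koszulProj_list_tmul _ r n).trans ?_
  rw [rgenProj_list_apply _ (fun y => Finset.mem_toList.2 (Finset.mem_univ y))]
  change _ = koszulAug V (r ⊗ₜ ximon n) • ((1 : Rgen V) ⊗ₜ[F2] ximon (0 : V →₀ ℕ))
  rw [koszulAug_tmul]
  by_cases hn : n = 0
  · simp [hn, ximon, TensorProduct.smul_tmul']
  · have hne : ¬ ∀ y : V, n y = 0 := fun h => hn (Finsupp.ext h)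
    simp [hne, ximon, hn]

end Koszul

section CollapseRgen

variable {W X : Type} [Fintype W] [DecidableEq X]

/-- The map `R_σ`, sending a color to the sum of the colors in its fibre. -/
def collapseRgen (σ : W → X) : Rgen X →ₐ[F2] Rgen W :=
  rgenLift (fun x => ∑ w ∈ Finset.univ.filter (fun w => σ w = x), rgen w)
    fun _ => sum_mul_self_eq_zero F2_add_self _ rgen_mul_self (fun _ _ => Commute.all _ _) _

theorem collapseRgen_rgen (σ : W → X) (x : X) :
    collapseRgen σ (rgen x) = ∑ w ∈ Finset.univ.filter (fun w => σ w = x), rgen w :=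
  rgenLift_rgen _ _ x

omit [Fintype W] in
theorem rgenLift_sum_rgen {A : Type} [CommRing A] [Algebra F2 A] (f : W → A)
    (hf : ∀ w, f w * f w = 0) (T : Finset W) :
    rgenLift f hf (∑ w ∈ T, rgen w) = ∑ w ∈ T, f w := by
  simp only [map_sum, rgenLift_rgen]

theorem rgenAug_collapseRgen (σ : W → X) (r : Rgen X) :
    rgenAug (collapseRgen σ r) = rgenAug r := by
  have h : rgenAug.comp (collapseRgen σ) = rgenAug :=
    rgen_algHom_ext fun x => by simp [collapseRgen_rgen, rgenAug]
  exact DFunLike.congr_fun h r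

variable [DecidableEq W]

theorem sum_fiber_surjInv {M : Type} [AddCommMonoid M] {σ : W → X} {τ : X → W}
    (hτ : ∀ x, σ (τ x) = x) (f : W → M) (x : X) :
    ∑ w ∈ Finset.univ.filter (fun w => σ w = x), f w =
      f (τ x) + ∑ z ∈ Finset.univ.filter
        (fun z : {w // w ≠ τ (σ w)} => σ z = x), f z := by
  rw [← Finset.add_sum_erase _ f (a := τ x) (by simp [hτ])]
  congr 1
  symm
  refine Finset.sum_bij (fun z _ => z.1) ?_ ?_ ?_ ?_
  · rintro ⟨z, hz⟩ hzx
    simp only [Finset.mem_filter, Finset.mem_univ, true_and] at hzx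
    subst hzx
    simpa using hz
  · exact fun _ _ _ _ h => Subtype.ext h
  · intro w hw
    simp only [Finset.mem_erase, Finset.mem_filter, Finset.mem_univ, true_and] at hw
    obtain ⟨hne, rfl⟩ := hw
    exact ⟨⟨w, hne⟩, by simp, rfl⟩
  · exact fun _ _ => rfl

omit [Fintype W] [DecidableEq X] [DecidableEq W] in
theorem tmul_one_add_one_tmul_mul_self {A B : Type} [CommRing A] [Algebra F2 A] [CommRing B]
    [Algebra F2 B] {a : A} {b : B} (ha : a * a = 0) (hb : b * b = 0) :
    (a ⊗ₜ[F2] (1 : B) + (1 : A) ⊗ₜ[F2] b) * (a ⊗ₜ[F2] (1 : B) + (1 : A) ⊗ₜ[F2] b) = 0 := by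
  simp only [mul_add, add_mul, Algebra.TensorProduct.tmul_mul_tmul, ha, hb,
    TensorProduct.tmul_zero, TensorProduct.zero_tmul, mul_one, one_mul, zero_add, add_zero]
  exact F2_add_self _

/-- The image of a color under the inverse of `collapseTensorEquiv`. -/
def collapseTensorGen (σ : W → X) (τ : X → W) (w : W) :
    Rgen X ⊗[F2] Rgen {w // w ≠ τ (σ w)} :=
  if h : w ≠ τ (σ w) then 1 ⊗ₜ rgen ⟨w, h⟩ else
    rgen (σ w) ⊗ₜ 1 + 1 ⊗ₜ ∑ z ∈ Finset.univ.filter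
      (fun z : {w // w ≠ τ (σ w)} => σ z = σ w), rgen z

theorem collapseTensorGen_mul_self (σ : W → X) (τ : X → W) (w : W) :
    collapseTensorGen σ τ w * collapseTensorGen σ τ w = 0 := by
  have hsum := sum_mul_self_eq_zero F2_add_self _ rgen_mul_self (fun _ _ => Commute.all _ _)
    (Finset.univ.filter (fun z : {w // w ≠ τ (σ w)} => σ z = σ w))
  rw [collapseTensorGen]
  split_ifs
  · rw [Algebra.TensorProduct.tmul_mul_tmul, rgen_mul_self, TensorProduct.tmul_zero]
  · exact tmul_one_add_one_tmul_mul_self (rgen_mul_self _) hsum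

/-- For a section `τ` of `σ`, the algebra `Rgen W` is freely generated over `Rgen X` by the
colors outside the image of `τ`. -/
def collapseTensorEquiv (σ : W → X) (τ : X → W) (hτ : ∀ x, σ (τ x) = x) :
    Rgen X ⊗[F2] Rgen {w // w ≠ τ (σ w)} ≃ₐ[F2] Rgen W :=
  AlgEquiv.ofAlgHom
    (Algebra.TensorProduct.productMap (collapseRgen σ)
      (rgenLift (fun z => rgen z.1) fun z => rgen_mul_self z.1))
    (rgenLift (collapseTensorGen σ τ) (collapseTensorGen_mul_self σ τ))
    (rgen_algHom_ext fun w => by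
      simp only [AlgHom.comp_apply, rgenLift_rgen, AlgHom.id_apply, collapseTensorGen]
      split_ifs with h
      · simp
      · rw [not_not] at h
        simp only [map_add, map_sum, Algebra.TensorProduct.productMap_apply_tmul, map_one, mul_one,
          one_mul, rgenLift_rgen, collapseRgen_rgen, sum_fiber_surjInv hτ, ← h]
        rw [add_assoc, F2_add_self, add_zero])
    (by
      refine Algebra.TensorProduct.ext (rgen_algHom_ext fun x => ?_) (rgen_algHom_ext fun z => ?_)
      · simp only [AlgHom.comp_apply, AlgHom.id_apply, Algebra.TensorProduct.includeLeft_apply,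
          Algebra.TensorProduct.productMap_apply_tmul, map_one, mul_one, collapseRgen_rgen]
        refine (rgenLift_sum_rgen _ _ _).trans ?_
        rw [sum_fiber_surjInv hτ]
        have h1 : ¬ τ x ≠ τ (σ (τ x)) := by simp [hτ]
        have h2 : ∀ z : {w // w ≠ τ (σ w)}, collapseTensorGen σ τ z = 1 ⊗ₜ rgen z :=
          fun z => dif_pos z.2
        simp only [h2, ← TensorProduct.tmul_sum]
        rw [collapseTensorGen, dif_neg h1, hτ, add_assoc, F2_add_self, add_zero]
      · simp only [AlgHom.comp_apply, AlgHom.id_apply, Algebra.TensorProduct.includeRight_apply,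
          AlgHom.restrictScalars_apply,
          Algebra.TensorProduct.productMap_apply_tmul, map_one, one_mul, rgenLift_rgen]
        exact dif_pos z.2)

end CollapseRgen

section CollapseXi

variable {W X : Type}

/-- The map `Ξ_σ`, sending a monomial to the sum of the monomials which push forward to it. -/
def collapseXi (σ : W → X) : XiX X →ₗ[F2] XiX W :=
  Finsupp.linearCombination F2 fun n : X →₀ ℕ =>
    ∑ᶠ m ∈ {m : W →₀ ℕ | Finsupp.mapDomain σ m = n}, ximon m

theorem collapseXi_ximon (σ : W → X) (n : X →₀ ℕ) :
    collapseXi σ (ximon n) =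
      ∑ᶠ m ∈ {m : W →₀ ℕ | Finsupp.mapDomain σ m = n}, ximon m := by
  simp [collapseXi, ximon]

theorem le_mapDomain_apply (σ : W → X) (m : W →₀ ℕ) (w : W) :
    m w ≤ Finsupp.mapDomain σ m (σ w) := by
  conv_rhs => rw [← Finsupp.single_add_erase w m, Finsupp.mapDomain_add, Finsupp.mapDomain_single]
  simp

variable [Fintype W]

theorem finite_mapDomain_fiber (σ : W → X) (n : X →₀ ℕ) :
    {m : W →₀ ℕ | Finsupp.mapDomain σ m = n}.Finite := by
  classical
  refine (Set.finite_Icc (0 : W →₀ ℕ)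
    (Finsupp.equivFunOnFinite.symm fun w => n (σ w))).subset ?_
  rintro m rfl
  exact ⟨zero_le, fun w => le_mapDomain_apply σ m w⟩

theorem collapseXi_ximon_eq_sum (σ : W → X) (n : X →₀ ℕ) :
    collapseXi σ (ximon n) = ∑ m ∈ (finite_mapDomain_fiber σ n).toFinset, ximon m := by
  rw [collapseXi_ximon, finsum_mem_eq_finite_toFinset_sum _ (finite_mapDomain_fiber σ n)]

variable [DecidableEq X]

theorem collapseXi_ximon_apply (σ : W → X) (n : X →₀ ℕ) (m : W →₀ ℕ) :
    collapseXi σ (ximon n) m = if Finsupp.mapDomain σ m = n then 1 else 0 := by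
  classical
  rw [collapseXi_ximon_eq_sum, Finsupp.finsetSum_apply]
  simp [ximon, Finsupp.single_apply]

theorem collapseXi_ximon_zero (σ : W → X) : collapseXi σ (ximon 0) = ximon 0 := by
  classical
  ext m
  have h : Finsupp.mapDomain σ m = 0 ↔ m = 0 := by
    refine ⟨fun h => ?_, fun h => by simp [h]⟩
    ext w
    simpa [h] using le_mapDomain_apply σ m w
  simp only [collapseXi_ximon_apply, h]
  simp [ximon, Finsupp.single_apply, eq_comm]

theorem collapseXi_apply_zero (σ : W → X) (v : XiX X) : collapseXi σ v 0 = v 0 := by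
  have h : Finsupp.lapply 0 ∘ₗ collapseXi σ = (Finsupp.lapply 0 : XiX X →ₗ[F2] F2) := by
    refine xiX_ext fun n => ?_
    simp only [LinearMap.comp_apply, Finsupp.lapply_apply, collapseXi_ximon_apply]
    simp [ximon, Finsupp.single_apply, eq_comm]
  exact DFunLike.congr_fun h v

theorem xiMul_collapseXi [DecidableEq W] (σ : W → X) (w : W) (v : XiX X) :
    xiMul w (collapseXi σ v) = collapseXi σ (xiMul (σ w) v) := by
  have h : xiMul w ∘ₗ collapseXi σ = collapseXi σ ∘ₗ xiMul (σ w) := by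
    refine xiX_ext fun n => ?_
    ext m
    simp only [LinearMap.comp_apply, xiMul_apply, collapseXi_ximon_apply, xiMul_ximon,
      Finsupp.mapDomain_add, Finsupp.mapDomain_single]
    by_cases hn : n (σ w) = 0
    · have hne : Finsupp.mapDomain σ m + Finsupp.single (σ w) 1 ≠ n := by rintro rfl; simp at hn
      simp [hn, hne]
    · have hle : Finsupp.single (σ w) 1 ≤ n := by
        rw [Finsupp.single_le_iff]; omega
      have hiff : Finsupp.mapDomain σ m + Finsupp.single (σ w) 1 = n ↔
          Finsupp.mapDomain σ m = n - Finsupp.single (σ w) 1 :=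
        (eq_tsub_iff_add_eq_of_le hle).symm
      simp [hn, hiff, collapseXi_ximon_apply]
  exact DFunLike.congr_fun h v

end CollapseXi

section KoszulCollapse

/-- Chains of polynomial degree less than `k` lie in the span of the basis elements of degree
less than `k`. -/
theorem tmul_ximon_mem_span {R S V κ : Type} [CommRing R] [Algebra F2 R] [CommRing S]
    [Algebra F2 S] [Algebra R S] [IsScalarTower F2 R S] (b : Module.Basis κ R S) (s : S)
    {n : V →₀ ℕ} {k : ℕ} (hn : n.degree < k) :
    s ⊗ₜ[F2] ximon n ∈ Submodule.span R
      (b.tensorProduct (Finsupp.basisSingleOne : Module.Basis (V →₀ ℕ) F2 (XiX V)) ''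
        {j | j.2.degree < k}) := by
  induction b.mem_span s using Submodule.span_induction with
  | mem x hx =>
    obtain ⟨i, rfl⟩ := hx
    exact Submodule.subset_span ⟨(i, n), hn, by simp [Module.Basis.tensorProduct_apply, ximon]⟩
  | zero => simp
  | add x y _ _ hx hy => rw [TensorProduct.add_tmul]; exact add_mem hx hy
  | smul r x _ hx => rw [← TensorProduct.smul_tmul']; exact Submodule.smul_mem _ _ hx

theorem koszul_tmul_ximon_mem_span {R V κ : Type} [Fintype V] [DecidableEq V] [CommRing R]
    [Algebra F2 R] [Algebra R (Rgen V)] [IsScalarTower F2 R (Rgen V)]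
    (b : Module.Basis κ R (Rgen V)) (s : Rgen V) (n : V →₀ ℕ) :
    koszul V (s ⊗ₜ ximon n) ∈ Submodule.span R
      (b.tensorProduct (Finsupp.basisSingleOne : Module.Basis (V →₀ ℕ) F2 (XiX V)) ''
        {j | j.2.degree < n.degree}) := by
  rw [koszul_tmul]
  refine sum_mem fun y _ => ?_
  rw [xiMul_ximon]
  split_ifs with hy
  · simp
  · refine tmul_ximon_mem_span b _ ?_
    have hle : Finsupp.single y 1 ≤ n := by
      rw [Finsupp.single_le_iff]; omega
    conv_rhs => rw [← tsub_add_cancel_of_le hle]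
    simp

variable {W X : Type} [Fintype W] [Fintype X] [DecidableEq W] [DecidableEq X]

/-- The map `R_σ ⊗ Ξ_σ` of Koszul complexes. -/
def koszulCollapse {W X : Type} [Fintype W] [DecidableEq X] (σ : W → X) :
    Rgen X ⊗[F2] XiX X →ₗ[F2] Rgen W ⊗[F2] XiX W :=
  TensorProduct.map (collapseRgen σ).toLinearMap (collapseXi σ)

theorem koszulCollapse_koszul (σ : W → X) (z : Rgen X ⊗[F2] XiX X) :
    koszulCollapse σ (koszul X z) = koszul W (koszulCollapse σ z) := by
  induction z using TensorProduct.induction_on with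
  | zero => simp
  | add z w hz hw => simp only [map_add, hz, hw]
  | tmul r v =>
    simp only [koszulCollapse, koszul_tmul, map_sum, TensorProduct.map_tmul,
      AlgHom.toLinearMap_apply, map_mul, collapseRgen_rgen, Finset.sum_mul,
      TensorProduct.sum_tmul, xiMul_collapseXi]
    rw [← Finset.sum_fiberwise Finset.univ σ]
    refine Finset.sum_congr rfl fun x _ => Finset.sum_congr rfl fun w hw => ?_
    rw [(Finset.mem_filter.1 hw).2]

omit [Fintype X] [DecidableEq W] in
theorem koszulAug_koszulCollapse (σ : W → X) (z : Rgen X ⊗[F2] XiX X) :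
    koszulAug W (koszulCollapse σ z) = koszulAug X z := by
  induction z using TensorProduct.induction_on with
  | zero => simp
  | add z w hz hw => simp only [map_add, hz, hw]
  | tmul r v =>
    simp only [koszulCollapse, TensorProduct.map_tmul, koszulAug_tmul, AlgHom.toLinearMap_apply,
      rgenAug_collapseRgen, collapseXi_apply_zero]

omit [Fintype X] [DecidableEq W] in
theorem koszulCollapse_one (σ : W → X) :
    koszulCollapse σ (1 ⊗ₜ ximon 0) = 1 ⊗ₜ ximon 0 := by
  simp [koszulCollapse, collapseXi_ximon_zero]

/-- The mapping cone of `koszulCollapse` is exact. -/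
theorem koszulCollapse_cone_exact (σ : W → X) (x : Rgen X ⊗[F2] XiX X) (y : Rgen W ⊗[F2] XiX W)
    (hx : koszul X x = 0) (hy : koszulCollapse σ x + koszul W y = 0) :
    ∃ x' y', koszul X x' = x ∧ koszulCollapse σ x' + koszul W y' = y := by
  obtain ⟨S, hS⟩ := exists_koszul_contraction (V := X)
  obtain ⟨T, hT⟩ := exists_koszul_contraction (V := W)
  have hxy : koszulCollapse σ x = koszul W y :=
    (eq_neg_of_add_eq_zero_left hy).trans (neg_eq_of_add_eq_zero_left (F2_add_self _))
  have haug : koszulAug X x = 0 := by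
    rw [← koszulAug_koszulCollapse σ, hxy, koszulAug_koszul]
  have hSx : koszul X (S x) = x := by rw [hS x hx, haug, zero_smul, add_zero]
  set u := koszulCollapse σ (S x) + y with hu
  have hcyc : koszul W u = 0 := by
    rw [hu, map_add, ← koszulCollapse_koszul, hSx, hy]
  set e := koszulAug W u with he
  have hone : koszul X (e • (1 ⊗ₜ ximon 0)) = 0 := by
    rw [LinearMap.map_smul_of_tower, koszul_one, smul_zero]
  refine ⟨S x + e • (1 ⊗ₜ ximon 0), T u, by rw [map_add, hSx, hone, add_zero], ?_⟩
  rw [hT u hcyc, ← he, map_add, map_smul, koszulCollapse_one, hu]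
  have h2 : ∀ a b c : Rgen W ⊗[F2] XiX W, a + b + (a + c + b) = c := fun a b c => by
    rw [show a + b + (a + c + b) = (a + a) + (b + b) + c by abel, F2_add_self, F2_add_self,
      zero_add, zero_add]
  exact h2 _ _ _

theorem free_of_tensorEquiv {K R B S : Type} [Field K] [CommRing R] [CommRing B] [CommRing S]
    [Algebra K R] [Algebra K B] [Algebra K S] [Algebra R S] (e : R ⊗[K] B ≃ₐ[K] S)
    (he : ∀ r, e (r ⊗ₜ 1) = algebraMap R S r) : Module.Free R S := by
  have hmul : ∀ (r : R) (z : R ⊗[K] B), e (r • z) = r • e z := fun r z => by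
    rw [Algebra.smul_def r (e z), ← he, ← map_mul, Algebra.smul_def,
      Algebra.TensorProduct.algebraMap_apply, Algebra.algebraMap_self_apply]
  let e' : R ⊗[K] B ≃ₗ[R] S := { e.toEquiv with map_add' := map_add e, map_smul' := hmul }
  exact Module.Free.of_equiv e'

omit [Fintype X] in
theorem collapseTensorEquiv_tmul_one (σ : W → X) (τ : X → W) (hτ : ∀ x, σ (τ x) = x)
    (r : Rgen X) : collapseTensorEquiv σ τ hτ (r ⊗ₜ 1) = collapseRgen σ r := by
  rw [collapseTensorEquiv, AlgEquiv.ofAlgHom_apply, Algebra.TensorProduct.productMap_apply_tmul,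
    map_one, mul_one]

theorem exists_koszulCollapse_homotopy_inverse (σ : W → X) (hσ : Function.Surjective σ) :
    ∃ (g : Rgen W ⊗[F2] XiX W →ₗ[F2] Rgen X ⊗[F2] XiX X)
      (h : Rgen X ⊗[F2] XiX X →ₗ[F2] Rgen X ⊗[F2] XiX X)
      (k : Rgen W ⊗[F2] XiX W →ₗ[F2] Rgen W ⊗[F2] XiX W),
      (∀ (r : Rgen X) z, g (collapseRgen σ r • z) = r • g z) ∧
      (∀ (r : Rgen X) z, h (r • z) = r • h z) ∧
      (∀ (r : Rgen X) z, k (collapseRgen σ r • z) = collapseRgen σ r • k z) ∧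
      (∀ z, g (koszul W z) = koszul X (g z)) ∧
      (∀ z, koszul X (h z) + h (koszul X z) = g (koszulCollapse σ z) + z) ∧
      ∀ z, koszul W (k z) + k (koszul W z) = koszulCollapse σ (g z) + z := by
  let _ : Algebra (Rgen X) (Rgen W) := (collapseRgen σ).toRingHom.toAlgebra
  have : IsScalarTower F2 (Rgen X) (Rgen W) := IsScalarTower.of_algHom (collapseRgen σ)
  have hsmul : ∀ (r : Rgen X) (z : Rgen W ⊗[F2] XiX W), r • z = collapseRgen σ r • z :=
    fun r z => (algebraMap_smul (Rgen W) r z).symm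
  have hτ : ∀ x, σ (Function.surjInv hσ x) = x := Function.surjInv_eq hσ
  have hfree : Module.Free (Rgen X) (Rgen W) :=
    free_of_tensorEquiv (collapseTensorEquiv σ (Function.surjInv hσ) hτ)
      (collapseTensorEquiv_tmul_one σ _ hτ)
  let b := Module.Free.chooseBasis (Rgen X) (Rgen W)
  let f : Rgen X ⊗[F2] XiX X →ₗ[Rgen X] Rgen W ⊗[F2] XiX W :=
    TensorProduct.AlgebraTensorModule.map (Algebra.linearMap (Rgen X) (Rgen W)) (collapseXi σ)
  have hf : ∀ z, f z = koszulCollapse σ z := fun z => rfl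
  obtain ⟨g, h, k, hg, hh, hk⟩ := exists_homotopy_inverse (R := Rgen X)
    (P := Rgen X ⊗[F2] XiX X) (Q := Rgen W ⊗[F2] XiX W) F2_add_self F2_add_self
    ((Module.Basis.singleton Unit (Rgen X)).tensorProduct
      (Finsupp.basisSingleOne : Module.Basis (X →₀ ℕ) F2 (XiX X)))
    (b.tensorProduct (Finsupp.basisSingleOne : Module.Basis (W →₀ ℕ) F2 (XiX W)))
    (fun j => j.2.degree) (fun j => j.2.degree) (koszul X)
    ((koszul W).restrictScalars (Rgen X)) f koszul_koszul koszul_koszul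
    (koszulCollapse_koszul σ) (koszulCollapse_cone_exact σ)
    (by
      rintro ⟨i, n⟩
      rw [Module.Basis.tensorProduct_apply, Finsupp.coe_basisSingleOne]
      exact koszul_tmul_ximon_mem_span _ _ n)
    (by
      rintro ⟨i, n⟩
      rw [Module.Basis.tensorProduct_apply, Finsupp.coe_basisSingleOne]
      exact koszul_tmul_ximon_mem_span _ _ n)
    (by
      rintro ⟨i, n⟩
      rw [Module.Basis.tensorProduct_apply, Finsupp.coe_basisSingleOne]
      change koszulCollapse σ (_ ⊗ₜ ximon n) ∈ _
      rw [koszulCollapse, TensorProduct.map_tmul, collapseXi_ximon_eq_sum, TensorProduct.tmul_sum]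
      refine sum_mem fun m hm => tmul_ximon_mem_span b _ ?_
      have hmn : Finsupp.mapDomain σ m = n := by simpa using hm
      simp [← hmn, Finsupp.degree_mapDomain])
  refine ⟨g.restrictScalars F2, h.restrictScalars F2, k.restrictScalars F2,
    fun r z => ?_, fun r z => h.map_smul r z, fun r z => ?_, hg, hh, hk⟩
  · rw [← hsmul]; exact g.map_smul r z
  · rw [← hsmul, ← hsmul]; exact k.map_smul r z

end KoszulCollapse

section Twist

/-- The product of the factors `1 + t y` conjugates `a y` to `a y + r y`. -/
theorem exists_prod_one_add_conj {ι A : Type} [DecidableEq ι] [Ring A] (h2 : ∀ x : A, x + x = 0)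
    (t a r : ι → A) (ht : ∀ y, t y * t y = 0) (htt : ∀ y z, Commute (t y) (t z))
    (hta : ∀ y, t y * a y = a y * t y + r y) (hta' : ∀ y z, z ≠ y → Commute (t y) (a z))
    (htr : ∀ y z, Commute (t y) (r z)) (hrt : ∀ y, r y * t y = 0)
    (M : Type) [AddCommGroup M] [Module A M] (T : Finset ι) :
    ∃ ψ : A, ψ * ψ = 1 ∧ (∀ x, (∀ y, Commute (t y) x) → Commute ψ x) ∧
      (∀ y, ψ * a y = (a y + if y ∈ T then r y else 0) * ψ) ∧
      ∀ v : M, (∀ y, t y • v = 0) → ψ • v = v := by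
  induction T using Finset.induction_on with
  | empty => exact ⟨1, by simp, by simp, by simp, by simp⟩
  | insert z T hz ih =>
    obtain ⟨ψ, hψ, hcomm, ha, hfix⟩ := ih
    have hψt : Commute ψ (1 + t z) :=
      (Commute.one_right ψ).add_right (hcomm _ fun y => htt y z)
    have hsq : (1 + t z) * (1 + t z) = 1 := by
      rw [add_mul, mul_add, mul_add, ht, one_mul, mul_one, one_mul, add_zero, add_assoc, h2,
        add_zero]
    refine ⟨(1 + t z) * ψ, ?_, fun x hx => ?_, fun y => ?_, fun v hv => ?_⟩
    · rw [mul_assoc, ← mul_assoc ψ, hψt.eq, mul_assoc, hψ, mul_one, hsq]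
    · exact ((Commute.one_left x).add_left (hx z)).mul_left (hcomm x hx)
    · rw [mul_assoc, ha, ← mul_assoc, ← mul_assoc]
      congr 1
      by_cases hy : y = z
      · subst hy
        rw [if_neg hz, if_pos (Finset.mem_insert_self _ _), add_zero, add_mul, one_mul, hta,
          mul_add, mul_one, add_mul, hrt]
        abel
      · have hmem : y ∈ insert z T ↔ y ∈ T := by simp [hy]
        simp only [hmem]
        have hc : Commute (t z) (a y + if y ∈ T then r y else 0) := by
          refine (hta' z y hy).add_right ?_
          split_ifs
          · exact htr z y
          · exact Commute.zero_right _
        exact ((Commute.one_left _).add_left hc).eq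
    · rw [mul_smul, hfix v hv, add_smul, one_smul, hv, add_zero]

open TensorProduct in
theorem exists_tensor_twist {ι P C : Type} [Fintype ι] [DecidableEq ι] [AddCommGroup P]
    [Module F2 P] [AddCommGroup C] [Module F2 C] (A D : ι → Module.End F2 P)
    (hDD : ∀ y z, D y ∘ₗ D z = D z ∘ₗ D y) (hD : ∀ y, D y ∘ₗ D y = 0)
    (hDA : ∀ y, D y ∘ₗ A y = A y ∘ₗ D y + LinearMap.id)
    (hDA' : ∀ y z, z ≠ y → D y ∘ₗ A z = A z ∘ₗ D y)
    (ρ : ι → Module.End F2 C) (hρ : ∀ y, ρ y ∘ₗ ρ y = 0)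
    (hρρ : ∀ y z, ρ y ∘ₗ ρ z = ρ z ∘ₗ ρ y) :
    ∃ ψ : Module.End F2 (P ⊗[F2] C), ψ ∘ₗ ψ = LinearMap.id ∧
      (∀ (f : Module.End F2 P) (e : Module.End F2 C), (∀ y, D y ∘ₗ f = f ∘ₗ D y) →
        (∀ y, ρ y ∘ₗ e = e ∘ₗ ρ y) → ψ ∘ₗ map f e = map f e ∘ₗ ψ) ∧
      (∀ y, ψ ∘ₗ map (A y) LinearMap.id =
        (map (A y) LinearMap.id + map LinearMap.id (ρ y)) ∘ₗ ψ) ∧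
      ∀ p c, (∀ y, D y p = 0) → ψ (p ⊗ₜ c) = p ⊗ₜ c := by
  obtain ⟨ψ, hψ, hcomm, ha, hfix⟩ := exists_prod_one_add_conj
    (A := Module.End F2 (P ⊗[F2] C)) F2_add_self (fun y => map (D y) (ρ y))
    (fun y => map (A y) LinearMap.id) (fun y => map LinearMap.id (ρ y))
    (fun y => by
      rw [Module.End.mul_eq_comp, ← map_comp, hD, map_zero_left])
    (fun y z => by
      rw [commute_iff_eq, Module.End.mul_eq_comp, Module.End.mul_eq_comp, ← map_comp, ← map_comp,
        hDD, hρρ])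
    (fun y => by
      rw [Module.End.mul_eq_comp, Module.End.mul_eq_comp, ← map_comp, ← map_comp, hDA,
        map_add_left, LinearMap.comp_id, LinearMap.id_comp])
    (fun y z hz => by
      rw [commute_iff_eq, Module.End.mul_eq_comp, Module.End.mul_eq_comp, ← map_comp, ← map_comp,
        hDA' y z hz, LinearMap.comp_id, LinearMap.id_comp])
    (fun y z => by
      rw [commute_iff_eq, Module.End.mul_eq_comp, Module.End.mul_eq_comp, ← map_comp, ← map_comp,
        hρρ, LinearMap.comp_id, LinearMap.id_comp])
    (fun y => by
      rw [Module.End.mul_eq_comp, ← map_comp, hρ, map_zero_right])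
    (P ⊗[F2] C) Finset.univ
  refine ⟨ψ, hψ, fun f e hf he => hcomm _ fun y => ?_, fun y => ?_, fun p c hp => hfix _ fun y => ?_⟩
  · rw [commute_iff_eq, Module.End.mul_eq_comp, Module.End.mul_eq_comp, ← map_comp, ← map_comp,
      hf, he]
  · have h := ha y
    rwa [if_pos (Finset.mem_univ y)] at h
  · simp [hp]

theorem comp_sum_eq_sum_comp {ι E : Type} [AddCommGroup E] [Module F2 E] {T : Finset ι}
    {ψ : Module.End F2 E} {a b : ι → Module.End F2 E} (h : ∀ i ∈ T, ψ ∘ₗ a i = b i ∘ₗ ψ) :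
    ψ ∘ₗ ∑ i ∈ T, a i = (∑ i ∈ T, b i) ∘ₗ ψ := by
  change ψ * _ = _ * ψ
  rw [Finset.mul_sum, Finset.sum_mul]
  exact Finset.sum_congr rfl h

end Twist

section Conjugation

theorem conj_homotopy_equivalence {E F : Type} [AddCommGroup E] [AddCommGroup F] [Module F2 E]
    [Module F2 F] {φ δ₀ δ : Module.End F2 E} {ψ ε₀ ε : Module.End F2 F} (hφ : φ ∘ₗ φ = LinearMap.id)
    (hψ : ψ ∘ₗ ψ = LinearMap.id) (hδ : φ ∘ₗ δ₀ = δ ∘ₗ φ) (hε : ψ ∘ₗ ε₀ = ε ∘ₗ ψ)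
    {f : E →ₗ[F2] F} {g : F →ₗ[F2] E} {h : Module.End F2 E} {k : Module.End F2 F}
    (hf : f ∘ₗ φ = ψ ∘ₗ f) (hg : g ∘ₗ ε₀ = δ₀ ∘ₗ g)
    (hh : δ₀ ∘ₗ h + h ∘ₗ δ₀ = g ∘ₗ f + LinearMap.id)
    (hk : ε₀ ∘ₗ k + k ∘ₗ ε₀ = f ∘ₗ g + LinearMap.id) :
    (φ ∘ₗ g ∘ₗ ψ) ∘ₗ ε = δ ∘ₗ φ ∘ₗ g ∘ₗ ψ ∧
      δ ∘ₗ (φ ∘ₗ h ∘ₗ φ) + (φ ∘ₗ h ∘ₗ φ) ∘ₗ δ = (φ ∘ₗ g ∘ₗ ψ) ∘ₗ f + LinearMap.id ∧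
      ε ∘ₗ (ψ ∘ₗ k ∘ₗ ψ) + (ψ ∘ₗ k ∘ₗ ψ) ∘ₗ ε = f ∘ₗ (φ ∘ₗ g ∘ₗ ψ) + LinearMap.id := by
  simp only [LinearMap.ext_iff, LinearMap.comp_apply, LinearMap.add_apply, LinearMap.id_apply]
    at *
  have hδ' : ∀ z, φ (δ z) = δ₀ (φ z) := fun z => by rw [← hφ (δ₀ (φ z)), hδ, hφ]
  have hε' : ∀ z, ψ (ε z) = ε₀ (ψ z) := fun z => by rw [← hψ (ε₀ (ψ z)), hε, hψ]
  refine ⟨fun z => by rw [hε', hg, hδ], fun z => ?_, fun z => ?_⟩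
  · rw [hδ', ← hδ, ← map_add, hh, map_add, hφ, hf]
  · rw [hε', ← hε, ← map_add, hk, map_add, hψ, hf]

end Conjugation

section KoszulTwist

open TensorProduct

variable {V W X C : Type}

/-- Multiplication by a color on the Koszul complex. -/
def koszulMul (r : Rgen V) : Module.End F2 (Rgen V ⊗[F2] XiX V) :=
  map (LinearMap.mulLeft F2 r) LinearMap.id

theorem koszulMul_apply (r : Rgen V) (z : Rgen V ⊗[F2] XiX V) : koszulMul r z = r • z := by
  induction z using TensorProduct.induction_on with
  | zero => rw [map_zero, smul_zero]
  | add z w hz hw => rw [map_add, smul_add, hz, hw]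
  | tmul s v => rfl

theorem exists_koszul_twist [Fintype V] [DecidableEq V] [AddCommGroup C] [Module F2 C]
    (d : C →ₗ[F2] C) (ρ : V → C →ₗ[F2] C) (hsq : ∀ y, ρ y ∘ₗ ρ y = 0)
    (hcomm : ∀ y z, ρ y ∘ₗ ρ z = ρ z ∘ₗ ρ y) (hd : ∀ y, ρ y ∘ₗ d = d ∘ₗ ρ y) :
    ∃ ψ : Module.End F2 (CbarY V C), ψ ∘ₗ ψ = LinearMap.id ∧
      ψ ∘ₗ (map LinearMap.id d + map ((koszul V).restrictScalars F2) LinearMap.id) =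
        delBar V C d ρ ∘ₗ ψ ∧
      (∀ y, ψ ∘ₗ midMul V C (rgen y) =
        (midMul V C (rgen y) + map LinearMap.id (ρ y)) ∘ₗ ψ) ∧
      ∀ v c, ψ ((1 ⊗ₜ v) ⊗ₜ c) = (1 ⊗ₜ v) ⊗ₜ c := by
  obtain ⟨ψ, hψ, hmap, ha, hfix⟩ := exists_tensor_twist (P := Rgen V ⊗[F2] XiX V) (C := C)
    (fun y => koszulMul (rgen y)) (fun y => map (rgenDeriv y) LinearMap.id)
    (fun y z => TensorProduct.ext' fun r v => by
      simp only [LinearMap.comp_apply, map_tmul, rgenDeriv_comm y z])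
    (fun y => TensorProduct.ext' fun r v => by
      simp only [LinearMap.comp_apply, map_tmul, rgenDeriv_self, zero_tmul, LinearMap.zero_apply])
    (fun y => TensorProduct.ext' fun r v => by
      simp only [LinearMap.comp_apply, koszulMul, map_tmul, LinearMap.mulLeft_apply,
        rgenDeriv_rgen_mul, if_true, add_tmul, LinearMap.add_apply, LinearMap.id_apply])
    (fun y z hz => TensorProduct.ext' fun r v => by
      simp only [LinearMap.comp_apply, koszulMul, map_tmul, LinearMap.mulLeft_apply,
        rgenDeriv_rgen_mul, if_neg hz, add_zero])
    ρ hsq hcomm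
  refine ⟨ψ, hψ, ?_, ha, fun v c => hfix (1 ⊗ₜ v) c fun y => ?_⟩
  · have hterm : ∀ y : V, map (koszulTerm y) LinearMap.id =
        map (koszulMul (rgen y)) LinearMap.id ∘ₗ
          map (map LinearMap.id (xiMul y)) (LinearMap.id : C →ₗ[F2] C) := fun y => by
      rw [← map_comp, koszulMul, ← map_comp, koszulTerm, LinearMap.comp_id, LinearMap.id_comp,
        LinearMap.id_comp]
    have hact : ∀ y, map (map (LinearMap.id : Rgen V →ₗ[F2] Rgen V) (xiMul y)) (ρ y) =
        map LinearMap.id (ρ y) ∘ₗ map (map LinearMap.id (xiMul y)) LinearMap.id := fun y => by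
      rw [← map_comp, LinearMap.comp_id, LinearMap.id_comp]
    have hxi : ∀ y, ψ ∘ₗ map (map LinearMap.id (xiMul y)) LinearMap.id =
        map (map LinearMap.id (xiMul y)) LinearMap.id ∘ₗ ψ := fun y =>
      hmap _ _ (fun z => by rw [← map_comp, ← map_comp, LinearMap.comp_id, LinearMap.id_comp,
        LinearMap.comp_id, LinearMap.id_comp]) fun z => rfl
    have hsum : map (∑ y : V, koszulTerm y) (LinearMap.id : C →ₗ[F2] C) =
        ∑ y, map (koszulTerm y) LinearMap.id := 
      map_sum (LinearMap.rTensorHom C) _ _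
    have hkoszul : (koszul V).restrictScalars F2 = ∑ y, koszulTerm y := koszul_restrictScalars
    rw [hkoszul, delBar, LinearMap.comp_add, LinearMap.add_comp,
      hmap LinearMap.id d (fun _ => rfl) hd, hsum]
    congr 1
    refine comp_sum_eq_sum_comp (E := CbarY V C) fun y _ => ?_
    rw [hact]
    change _ = (map (koszulTerm y) (LinearMap.id : C →ₗ[F2] C) + _) ∘ₗ ψ
    rw [hterm, ← LinearMap.add_comp, LinearMap.comp_assoc, ← hxi, ← LinearMap.comp_assoc,
      ← LinearMap.comp_assoc, ha]
  · rw [map_tmul, rgenDeriv_one, zero_tmul]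

theorem collapse_comp_twist [Fintype W] [Fintype X] [DecidableEq W] [DecidableEq X]
    [AddCommGroup C] [Module F2 C] (σ : W → X) (ρ : W → C →ₗ[F2] C)
    {φ : Module.End F2 (CbarY X C)} {ψ : Module.End F2 (CbarY W C)}
    (hφ : ∀ x, φ ∘ₗ midMul X C (rgen x) = (midMul X C (rgen x) +
      map LinearMap.id (∑ w ∈ Finset.univ.filter (fun w => σ w = x), ρ w)) ∘ₗ φ)
    (hψ : ∀ x, ψ ∘ₗ midMul W C (collapseRgen σ (rgen x)) =
      (midMul W C (collapseRgen σ (rgen x)) +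
      map LinearMap.id (∑ w ∈ Finset.univ.filter (fun w => σ w = x), ρ w)) ∘ₗ ψ)
    (hφ1 : ∀ v c, φ ((1 ⊗ₜ v) ⊗ₜ c) = (1 ⊗ₜ v) ⊗ₜ c)
    (hψ1 : ∀ v c, ψ ((1 ⊗ₜ v) ⊗ₜ c) = (1 ⊗ₜ v) ⊗ₜ c) :
    map (koszulCollapse σ) LinearMap.id ∘ₗ φ = ψ ∘ₗ map (koszulCollapse σ) LinearMap.id := by
  set F : CbarY X C →ₗ[F2] CbarY W C := map (koszulCollapse σ) LinearMap.id with hF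
  have hmid : ∀ x, F ∘ₗ midMul X C (rgen x) = midMul W C (collapseRgen σ (rgen x)) ∘ₗ F :=
    fun x => by
      refine TensorProduct.ext_threefold fun r v c => ?_
      simp only [hF, koszulCollapse, midMul, LinearMap.comp_apply, map_tmul,
        LinearMap.mulLeft_apply, AlgHom.toLinearMap_apply, map_mul, LinearMap.id_apply]
  have hact : ∀ e : C →ₗ[F2] C, F ∘ₗ map LinearMap.id e = map LinearMap.id e ∘ₗ F := fun e => by
    rw [hF, ← map_comp, ← map_comp, LinearMap.comp_id, LinearMap.id_comp, LinearMap.comp_id,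
      LinearMap.id_comp]
  refine TensorProduct.ext_threefold fun r v c => ?_
  rw [LinearMap.comp_apply, LinearMap.comp_apply]
  induction r using rgen_induction with
  | h0 => simp only [zero_tmul, map_zero]
  | h1 =>
    have h : F ((1 ⊗ₜ v) ⊗ₜ c) = (1 ⊗ₜ collapseXi σ v) ⊗ₜ c := by
      simp only [hF, koszulCollapse, map_tmul, AlgHom.toLinearMap_apply, map_one,
        LinearMap.id_apply]
    rw [hφ1, h, hψ1]
  | hadd r s hr hs => simp only [add_tmul, map_add, hr, hs]
  | hmul x r hr =>
    have hz : ((rgen x * r) ⊗ₜ v) ⊗ₜ c = midMul X C (rgen x) ((r ⊗ₜ v) ⊗ₜ c) := rfl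
    have hmid' := fun z => LinearMap.congr_fun (hmid x) z
    have hact' := fun e z => LinearMap.congr_fun (hact e) z
    have hφ' := fun z => LinearMap.congr_fun (hφ x) z
    have hψ' := fun z => LinearMap.congr_fun (hψ x) z
    simp only [LinearMap.comp_apply, LinearMap.add_apply] at hmid' hact' hφ' hψ'
    rw [hz, hφ', map_add, hmid', hact', hr, hmid', hψ']

end KoszulTwist

section Assembly

open TensorProduct

variable {P Q C : Type} [AddCommGroup P] [Module F2 P] [AddCommGroup Q] [Module F2 Q]
  [AddCommGroup C] [Module F2 C]

theorem map_comp_tensor_differential (d : Module.End F2 C) {δ : Module.End F2 P}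
    {ε : Module.End F2 Q} {g : Q →ₗ[F2] P} (hg : g ∘ₗ ε = δ ∘ₗ g) :
    map g LinearMap.id ∘ₗ (map LinearMap.id d + map ε LinearMap.id) =
      (map LinearMap.id d + map δ LinearMap.id) ∘ₗ map g LinearMap.id := by
  simp only [LinearMap.comp_add, LinearMap.add_comp, ← map_comp, LinearMap.comp_id,
    LinearMap.id_comp, hg]

theorem map_homotopy_tensor_differential (d : Module.End F2 C) {δ h : Module.End F2 P}
    {f : P →ₗ[F2] Q} {g : Q →ₗ[F2] P} (hh : δ ∘ₗ h + h ∘ₗ δ = g ∘ₗ f + LinearMap.id) :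
    (map LinearMap.id d + map δ LinearMap.id) ∘ₗ map h LinearMap.id +
        map h LinearMap.id ∘ₗ (map LinearMap.id d + map δ LinearMap.id) =
      map g LinearMap.id ∘ₗ map f LinearMap.id + LinearMap.id := by
  have hmap := congrArg (fun e => map e (LinearMap.id : C →ₗ[F2] C)) hh
  simp only [map_add_left, map_id] at hmap
  simp only [LinearMap.comp_add, LinearMap.add_comp, ← map_comp, LinearMap.comp_id,
    LinearMap.id_comp] at hmap ⊢
  rw [← hmap, add_add_add_comm, F2_add_self, zero_add]

theorem conj_comp_eq {a : Module.End F2 P} {b : Module.End F2 Q} {ρ : Module.End F2 C}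
    {φ : Module.End F2 (P ⊗[F2] C)} {ψ : Module.End F2 (Q ⊗[F2] C)} (hφφ : φ ∘ₗ φ = LinearMap.id)
    (hψ : ψ ∘ₗ map b LinearMap.id = (map b LinearMap.id + map LinearMap.id ρ) ∘ₗ ψ)
    (hφ : φ ∘ₗ map a LinearMap.id = (map a LinearMap.id + map LinearMap.id ρ) ∘ₗ φ)
    {g : Q →ₗ[F2] P} (hg : g ∘ₗ b = a ∘ₗ g) :
    (φ ∘ₗ map g LinearMap.id ∘ₗ ψ) ∘ₗ map b LinearMap.id =
      map a LinearMap.id ∘ₗ φ ∘ₗ map g LinearMap.id ∘ₗ ψ := by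
  have hφ' : φ ∘ₗ (map a LinearMap.id + map LinearMap.id ρ) = map a LinearMap.id ∘ₗ φ := by
    calc _ = φ ∘ₗ (map a LinearMap.id + map LinearMap.id ρ) ∘ₗ (φ ∘ₗ φ) := by
          rw [hφφ, LinearMap.comp_id]
      _ = (φ ∘ₗ φ) ∘ₗ map a LinearMap.id ∘ₗ φ := by
          rw [← LinearMap.comp_assoc φ φ, ← hφ]; rfl
      _ = _ := by rw [hφφ, LinearMap.id_comp]
  have hg' : map g LinearMap.id ∘ₗ (map b LinearMap.id + map LinearMap.id ρ) =
      (map a LinearMap.id + map LinearMap.id ρ) ∘ₗ map g LinearMap.id := by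
    simp only [LinearMap.comp_add, LinearMap.add_comp, ← map_comp, LinearMap.comp_id,
      LinearMap.id_comp, hg]
  calc _ = φ ∘ₗ map g LinearMap.id ∘ₗ ψ ∘ₗ map b LinearMap.id := rfl
    _ = φ ∘ₗ (map g LinearMap.id ∘ₗ (map b LinearMap.id + map LinearMap.id ρ)) ∘ₗ ψ := by
        rw [hψ]; rfl
    _ = (φ ∘ₗ (map a LinearMap.id + map LinearMap.id ρ)) ∘ₗ map g LinearMap.id ∘ₗ ψ := by
        rw [hg']; rfl
    _ = _ := by rw [hφ']; rfl

theorem conj_midMul_collapseRgen {W X : Type} [Fintype W] [DecidableEq X] (σ : W → X)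
    (ρ : W → C →ₗ[F2] C) {ψ : Module.End F2 (CbarY W C)}
    (hψ : ∀ w, ψ ∘ₗ midMul W C (rgen w) =
      (midMul W C (rgen w) + map LinearMap.id (ρ w)) ∘ₗ ψ) (x : X) :
    ψ ∘ₗ midMul W C (collapseRgen σ (rgen x)) = (midMul W C (collapseRgen σ (rgen x)) +
      map LinearMap.id (∑ w ∈ Finset.univ.filter (fun w => σ w = x), ρ w)) ∘ₗ ψ := by
  have hmid : midMul W C (collapseRgen σ (rgen x)) =
      ∑ w ∈ Finset.univ.filter (fun w => σ w = x), midMul W C (rgen w) := by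
    refine TensorProduct.ext_threefold fun r v c => ?_
    simp only [collapseRgen_rgen, midMul, LinearMap.sum_apply, map_tmul, LinearMap.mulLeft_apply,
      Finset.sum_mul, sum_tmul]
  have hact : map (LinearMap.id : Rgen W ⊗[F2] XiX W →ₗ[F2] _)
      (∑ w ∈ Finset.univ.filter (fun w => σ w = x), ρ w) =
      ∑ w ∈ Finset.univ.filter (fun w => σ w = x), map LinearMap.id (ρ w) :=
    map_sum (mapBilinear (RingHom.id F2) _ _ _ _ LinearMap.id) _ _
  rw [hmid, hact, ← Finset.sum_add_distrib]
  exact comp_sum_eq_sum_comp (E := CbarY W C) fun w _ => hψ w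

end Assembly

theorem stmt11 (W X : Type) [Fintype W] [Fintype X] [DecidableEq W] [DecidableEq X]
    (σ : W → X) (hσ : Function.Surjective σ)
    (d : C →ₗ[F2] C) (ρ : W → C →ₗ[F2] C)
    (hC : IsBddAboveComplex C d)
    (hsq : ∀ w, (ρ w).comp (ρ w) = 0)
    (hcomm : ∀ w w', (ρ w).comp (ρ w') = (ρ w').comp (ρ w))
    (hchain : ∀ w, (ρ w).comp d = d.comp (ρ w)) :
    ∃ Rσ : Rgen X →ₐ[F2] Rgen W,
      (∀ x : X, Rσ (rgen x) = ∑ w ∈ Finset.univ.filter (fun w => σ w = x), rgen w) ∧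
      ∃ Ξσ : XiX X →ₗ[F2] XiX W,
        (∀ n : X →₀ ℕ,
          Ξσ (ximon n) = ∑ᶠ m ∈ {m : W →₀ ℕ | Finsupp.mapDomain σ m = n}, ximon m) ∧
        -- σ̄ = Id_C ⊗ R_σ ⊗ Ξ_σ is an R_X-chain homotopy equivalence:
        ∃ (g : CbarY W C →ₗ[F2] CbarY X C)
          (Hh : CbarY X C →ₗ[F2] CbarY X C) (Hh' : CbarY W C →ₗ[F2] CbarY W C),
          -- g is a chain map
          g.comp (delBar W C d ρ) =
            (delBar X C d fun x => ∑ w ∈ Finset.univ.filter (fun w => σ w = x), ρ w).comp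
              g ∧
          -- g is R_X-linear
          (∀ x : X,
            g.comp (midMul W C (Rσ (rgen x))) = (midMul X C (rgen x)).comp g) ∧
          -- the homotopies are R_X-linear
          (∀ x : X, Hh.comp (midMul X C (rgen x)) = (midMul X C (rgen x)).comp Hh) ∧
          (∀ x : X,
            Hh'.comp (midMul W C (Rσ (rgen x))) = (midMul W C (Rσ (rgen x))).comp Hh') ∧
          -- ∂H + H∂ = g ∘ σ̄ + Id on C̄_X
          (delBar X C d fun x => ∑ w ∈ Finset.univ.filter (fun w => σ w = x), ρ w).comp
                Hh +
              Hh.comp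
                (delBar X C d fun x => ∑ w ∈ Finset.univ.filter (fun w => σ w = x), ρ w) =
            g.comp
                (TensorProduct.map (TensorProduct.map Rσ.toLinearMap Ξσ) LinearMap.id) +
              LinearMap.id ∧
          -- ∂H' + H'∂ = σ̄ ∘ g + Id on C̄_W
          (delBar W C d ρ).comp Hh' + Hh'.comp (delBar W C d ρ) =
            (TensorProduct.map (TensorProduct.map Rσ.toLinearMap Ξσ) LinearMap.id).comp
                g +
              LinearMap.id := by
  obtain ⟨g, h, k, hg, hh, hk, hgd, hhd, hkd⟩ := exists_koszulCollapse_homotopy_inverse σ hσ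
  have hsq' : ∀ x, (∑ w ∈ Finset.univ.filter (fun w => σ w = x), ρ w) ∘ₗ
      (∑ w ∈ Finset.univ.filter (fun w => σ w = x), ρ w) = 0 := fun x =>
    sum_mul_self_eq_zero (A := Module.End F2 C) F2_add_self ρ hsq hcomm _
  have hcomm' : ∀ x y, (∑ w ∈ Finset.univ.filter (fun w => σ w = x), ρ w) ∘ₗ
      (∑ w ∈ Finset.univ.filter (fun w => σ w = y), ρ w) =
      (∑ w ∈ Finset.univ.filter (fun w => σ w = y), ρ w) ∘ₗ
      (∑ w ∈ Finset.univ.filter (fun w => σ w = x), ρ w) := fun x y =>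
    (Commute.sum_left _ _ _ fun w _ => Commute.sum_right _ _ _ fun w' _ =>
      (hcomm w w' : Commute (S := Module.End F2 C) (ρ w) (ρ w')) :
      Commute (S := Module.End F2 C) _ _)
  have hchain' : ∀ x, (∑ w ∈ Finset.univ.filter (fun w => σ w = x), ρ w) ∘ₗ d =
      d ∘ₗ ∑ w ∈ Finset.univ.filter (fun w => σ w = x), ρ w := fun x =>
    (Commute.sum_left _ _ _ fun w _ => (hchain w : Commute (S := Module.End F2 C) (ρ w) d) :
      Commute (S := Module.End F2 C) _ _)
  obtain ⟨φ, hφφ, hφd, hφm, hφ1⟩ := exists_koszul_twist d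
    (fun x => ∑ w ∈ Finset.univ.filter (fun w => σ w = x), ρ w) hsq' hcomm' hchain'
  obtain ⟨ψ, hψψ, hψd, hψm, hψ1⟩ := exists_koszul_twist d ρ hsq hcomm hchain
  have hψm' := fun x => conj_midMul_collapseRgen σ ρ hψm x
  have hF := collapse_comp_twist σ ρ hφm hψm' hφ1 hψ1
  obtain ⟨hG, hH, hK⟩ := conj_homotopy_equivalence hφφ hψψ hφd hψd hF
    (map_comp_tensor_differential d (LinearMap.ext hgd))
    (map_homotopy_tensor_differential d (LinearMap.ext hhd))
    (map_homotopy_tensor_differential d (LinearMap.ext hkd))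
  have hg' : ∀ x, g ∘ₗ koszulMul (collapseRgen σ (rgen x)) = koszulMul (rgen x) ∘ₗ g :=
    fun x => LinearMap.ext fun z => by
      simp only [LinearMap.comp_apply, koszulMul_apply, hg]
  have hh' : ∀ x, h ∘ₗ koszulMul (rgen x) = koszulMul (rgen x) ∘ₗ h :=
    fun x => LinearMap.ext fun z => by
      simp only [LinearMap.comp_apply, koszulMul_apply, hh]
  have hk' : ∀ x, k ∘ₗ koszulMul (collapseRgen σ (rgen x)) =
      koszulMul (collapseRgen σ (rgen x)) ∘ₗ k :=
    fun x => LinearMap.ext fun z => by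
      simp only [LinearMap.comp_apply, koszulMul_apply, hk]
  exact ⟨collapseRgen σ, collapseRgen_rgen σ, collapseXi σ, collapseXi_ximon σ,
    φ ∘ₗ TensorProduct.map g LinearMap.id ∘ₗ ψ, φ ∘ₗ TensorProduct.map h LinearMap.id ∘ₗ φ,
    ψ ∘ₗ TensorProduct.map k LinearMap.id ∘ₗ ψ, hG,
    fun x => conj_comp_eq hφφ (hψm' x) (hφm x) (hg' x),
    fun x => conj_comp_eq hφφ (hφm x) (hφm x) (hh' x),
    fun x => conj_comp_eq hψψ (hψm' x) (hψm' x) (hk' x), hH, hK⟩
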